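/- arXiv:2007.06031 — 10 statements merged into one kernel-verified Lean document; each statement's English description precedes it below -/
import Mathlib

section
/- Let N be a relational NFA over an alphabet Σ with finitely many states and set L := L(N). Then the following are equivalent: (i) N is subatomic, i.e. for every state z the language L(N_{@z}) belongs to the Boolean subalgebra of the powerset of List Σ generated by the two-sided word quotients u⁻¹Lv⁻¹ := {w : u++w++v ∈ L} (u, v ranging over all words); (ii) for all words p and q: (for all words s, t: s++p++t ∈ L ↔ s++q++t ∈ L) holds if and only if (for every word x and every state z: p++x ∈ L(N_{@z}) ↔ q++x ∈ L(N_{@z})). Condition (ii) expresses that the transition monoid of the reachable subset construction of rev N is isomorphic to the syntactic monoid of L^r via the canonical map sending a word to its induced transition map. -/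
/-- A relational nondeterministic finite automaton over alphabet `σ` with states `Z`. -/
structure RelNFA (σ : Type*) (Z : Type*) where
  /-- initial states -/
  I : Set Z
  /-- final states -/
  F : Set Z
  /-- for each letter, a transition relation -/
  tr : σ → Z → Z → Prop

namespace RelNFA

variable {σ Z : Type*}

/-- `N_w`: the transition relation of the word `w`, with `N_ε` the identity
relation and `N_{u·a} = N_u ; N_a`. -/
def runRel (N : RelNFA σ Z) (w : List σ) : Z → Z → Prop :=
  w.foldl (fun R a => fun z z' => ∃ y, R z y ∧ N.tr a y z') Eq

/-- `N_w[S]`: the relational image of a set of states. -/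
def imgSet (N : RelNFA σ Z) (w : List σ) (S : Set Z) : Set Z :=
  {z' | ∃ z ∈ S, N.runRel w z z'}

/-- The language accepted by `N`: `{w : N_w[I] ∩ F ≠ ∅}`. -/
def lang (N : RelNFA σ Z) : Set (List σ) :=
  {w | (N.imgSet w N.I ∩ N.F).Nonempty}

/-- `L(N_{@z})`: the language accepted by `N` with initial states `{z}`. -/
def langFrom (N : RelNFA σ Z) (z : Z) : Set (List σ) :=
  {w | (N.imgSet w {z} ∩ N.F).Nonempty}

/-- The reverse nfa: swap initial and final states and take converse transitions. -/
def rev (N : RelNFA σ Z) : RelNFA σ Z where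
  I := N.F
  F := N.I
  tr := fun a z z' => N.tr a z' z

end RelNFA

/-- Membership in the Boolean subalgebra of the powerset of `α` generated by a
family `S` of subsets. -/
inductive BoolGen {α : Type*} (S : Set (Set α)) : Set α → Prop
  | base {X : Set α} : X ∈ S → BoolGen S X
  | bot : BoolGen S ∅
  | compl {X : Set α} : BoolGen S X → BoolGen S Xᶜ
  | union {X Y : Set α} : BoolGen S X → BoolGen S Y → BoolGen S (X ∪ Y)

namespace RelNFA

variable {σ Z : Type*} (N : RelNFA σ Z)

theorem runRel_append (u v : List σ) (z z' : Z) :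
    N.runRel (u ++ v) z z' ↔ ∃ y, N.runRel u z y ∧ N.runRel v y z' := by
  induction v using List.reverseRecOn generalizing z' with
  | nil => simp [runRel]
  | append_singleton v a ih =>
    have step (w : List σ) (x x' : Z) :
        N.runRel (w ++ [a]) x x' ↔ ∃ y, N.runRel w x y ∧ N.tr a y x' := by
      simp [runRel]
    rw [← List.append_assoc, step]
    simp only [step, ih]
    grind

theorem mem_lang (w : List σ) :
    w ∈ N.lang ↔ ∃ i ∈ N.I, ∃ f ∈ N.F, N.runRel w i f := by
  simp only [lang, imgSet, Set.Nonempty, Set.mem_inter_iff, Set.mem_ofPred_eq]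
  grind

theorem mem_langFrom (w : List σ) (z : Z) :
    w ∈ N.langFrom z ↔ ∃ f ∈ N.F, N.runRel w z f := by
  simp only [langFrom, imgSet, Set.Nonempty, Set.mem_inter_iff, Set.mem_ofPred_eq,
    Set.mem_singleton_iff]
  grind

theorem append_mem_lang (u v : List σ) :
    u ++ v ∈ N.lang ↔ ∃ i ∈ N.I, ∃ z, N.runRel u i z ∧ v ∈ N.langFrom z := by
  simp only [mem_lang, mem_langFrom, runRel_append]
  grind

/-- The quotient `u⁻¹Lv⁻¹` depends only on the transition relations of `u` and `v`. -/
theorem finite_quotients [Finite Z] :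
    {Y | ∃ u v : List σ, Y = {w | u ++ w ++ v ∈ N.lang}}.Finite := by
  refine (Set.finite_range fun R : (Z → Z → Prop) × (Z → Z → Prop) =>
    {w | ∃ i ∈ N.I, ∃ f ∈ N.F, ∃ y, (∃ x, R.1 i x ∧ N.runRel w x y) ∧ R.2 y f}).subset ?_
  rintro _ ⟨u, v, rfl⟩
  exact ⟨(N.runRel u, N.runRel v), by simp only [mem_lang, runRel_append]⟩

end RelNFA

namespace BoolGen

variable {α : Type*} {S : Set (Set α)}

theorem sUnion {C : Set (Set α)} (hC : C.Finite) (h : ∀ X ∈ C, BoolGen S X) :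
    BoolGen S (⋃₀ C) := by
  induction C, hC using Set.Finite.induction_on with
  | empty => simpa using BoolGen.bot
  | insert _ _ ih =>
    rw [Set.sUnion_insert]
    exact (h _ (Set.mem_insert _ _)).union (ih fun X hX => h X (Set.mem_insert_of_mem _ hX))

/-- Elements of the generated algebra do not separate points that no generator separates. -/
theorem mem_iff_mem {X : Set α} (hX : BoolGen S X) {p q : α}
    (h : ∀ Y ∈ S, p ∈ Y ↔ q ∈ Y) : p ∈ X ↔ q ∈ X := by
  induction hX with
  | base hY => exact h _ hY
  | bot => rfl
  | compl _ ih => exact not_congr ih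
  | union _ _ ih₁ ih₂ => exact or_congr ih₁ ih₂

theorem atom (hS : S.Finite) (p : α) : BoolGen S {q | ∀ Y ∈ S, p ∈ Y ↔ q ∈ Y} := by
  classical
  have h : BoolGen S (⋃₀ ((fun Y => if p ∈ Y then Yᶜ else Y) '' S)) := by
    refine sUnion (hS.image _) ?_
    rintro _ ⟨Y, hY, rfl⟩
    dsimp only
    split_ifs
    exacts [(base hY).compl, base hY]
  convert h.compl using 1
  ext q
  simp only [Set.mem_ofPred_eq, Set.mem_compl_iff, Set.sUnion_image, Set.mem_iUnion, not_exists]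
  refine forall₂_congr fun Y _ => ?_
  split_ifs with hp <;> simp [hp]

/-- A set that is saturated for a finite family is a Boolean combination of that family. -/
theorem of_saturated (hS : S.Finite) {X : Set α}
    (hX : ∀ p q, (∀ Y ∈ S, p ∈ Y ↔ q ∈ Y) → p ∈ X → q ∈ X) : BoolGen S X := by
  have hfin : ((fun p => {q | ∀ Y ∈ S, p ∈ Y ↔ q ∈ Y}) '' X).Finite := by
    refine (hS.finite_subsets.image fun T => {q | ∀ Y ∈ S, Y ∈ T ↔ q ∈ Y}).subset ?_
    rintro _ ⟨p, -, rfl⟩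
    refine ⟨{Y ∈ S | p ∈ Y}, Set.sep_subset _ _, ?_⟩
    ext q
    exact forall₂_congr fun Y hY => by simp [hY]
  convert sUnion (S := S) hfin (by rintro _ ⟨p, -, rfl⟩; exact atom hS p) using 1
  ext q
  simp only [Set.sUnion_image, Set.mem_iUnion, Set.mem_ofPred_eq, exists_prop]
  exact ⟨fun hq => ⟨q, hq, fun _ _ => Iff.rfl⟩, fun ⟨p, hp, h⟩ => hX p q h hp⟩

end BoolGen

/-- An nfa `N` (with finitely many states) is subatomic — every state accepts a
Boolean combination of two-sided word quotients `u⁻¹Lv⁻¹ = {w : u++w++v ∈ L}`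
of `L := L(N)` — iff for all words `p, q`: `p` and `q` are syntactically
congruent modulo `L` exactly when they act identically on the languages of the
states (`∀ x z, p++x ∈ L(N_{@z}) ↔ q++x ∈ L(N_{@z})`), i.e. iff the transition
monoid of the reachable subset construction of `rev N` is isomorphic to the
syntactic monoid of `L^r` via the canonical map. -/
theorem subatomic_iff_transition_monoid_syntactic {σ Z : Type*} [Fintype Z]
    (N : RelNFA σ Z) :
    (∀ z : Z,
      BoolGen {Y | ∃ u v : List σ, Y = {w | u ++ w ++ v ∈ N.lang}} (N.langFrom z)) ↔
    (∀ p q : List σ,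
      (∀ s t : List σ, s ++ p ++ t ∈ N.lang ↔ s ++ q ++ t ∈ N.lang) ↔
      (∀ (x : List σ) (z : Z), p ++ x ∈ N.langFrom z ↔ q ++ x ∈ N.langFrom z)) := by
  constructor
  · intro h p q
    constructor
    · intro hpq x z
      refine (h z).mem_iff_mem ?_
      rintro _ ⟨u, v, rfl⟩
      simpa using hpq u (x ++ v)
    · intro hpq s t
      simp only [List.append_assoc, N.append_mem_lang s, hpq]
  · intro h z
    refine BoolGen.of_saturated N.finite_quotients fun p q hpq hp => ?_
    have hact := (h p q).1 fun s t => hpq _ ⟨s, t, rfl⟩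
    simpa using (hact [] z).1 (by simpa using hp)
end

section
/- Dependency Lemma: for every language L ⊆ List Σ and all words u, v: u⁻¹L ⊄ [(Lv⁻¹)ᶜ]⁻¹L (i.e. u⁻¹L is not contained in the left quotient of L by the complement of the right word quotient Lv⁻¹) if and only if u++v ∈ L. -/
/-- Left quotient of a language by a single word: `u⁻¹L = {w : u++w ∈ L}`. -/
def leftQuot {σ : Type*} (u : List σ) (L : Set (List σ)) : Set (List σ) :=
  {w | u ++ w ∈ L}

/-- Left quotient of a language by a set of words: `U⁻¹L = {w : ∃ u ∈ U, u++w ∈ L}`. -/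
def leftQuotSet {σ : Type*} (U : Set (List σ)) (L : Set (List σ)) : Set (List σ) :=
  {w | ∃ u ∈ U, u ++ w ∈ L}

/-- Right quotient of a language by a single word: `Lv⁻¹ = {w : w++v ∈ L}`. -/
def rightQuot {σ : Type*} (L : Set (List σ)) (v : List σ) : Set (List σ) :=
  {w | w ++ v ∈ L}

/-- Dependency Lemma: `u⁻¹L ⊄ [(Lv⁻¹)ᶜ]⁻¹L  ↔  u++v ∈ L`. -/
theorem dependency_lemma {σ : Type*} (L : Set (List σ)) (u v : List σ) :
    ¬ (leftQuot u L ⊆ leftQuotSet (rightQuot L v)ᶜ L) ↔ u ++ v ∈ L := by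
  constructor
  · intro h
    by_contra huv
    exact h fun w hw => ⟨u, huv, hw⟩
  · intro huv h
    obtain ⟨x, hx, hxv⟩ := h (show v ∈ leftQuot u L from huv)
    exact hx hxv
end

section
/- Fundamental dualising map dr_L: for every language L ⊆ List Σ define dr_L(X) := [(Xᶜ)^r]⁻¹L = {w : ∃u ∉ X, u^r++w ∈ L}. Then: (1) for every set of words U, dr_L(U⁻¹L^r) = ⋃{u⁻¹L : u a word with u⁻¹L ∩ {v^r : v ∈ U} = ∅} (the alternative description, showing dr_L maps left quotients of L^r to left quotients of L); (2) for every X ∈ LQ(L^r), dr_{L^r}(dr_L(X)) = X; (3) consequently dr_L restricts to an inclusion-reversing bijection from LQ(L^r) onto LQ(L) with inverse dr_{L^r}. -/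
/-- The reverse of a language: `L^r = {w^r : w ∈ L} = {w : w^r ∈ L}`. -/
def revLang {σ : Type*} (L : Set (List σ)) : Set (List σ) :=
  {w | w.reverse ∈ L}

/-- The set of left quotients of `L`. -/
def LQ {σ : Type*} (L : Set (List σ)) : Set (Set (List σ)) :=
  {Y | ∃ U : Set (List σ), Y = leftQuotSet U L}

/-- The fundamental dualising map: `dr_L(X) := [(Xᶜ)^r]⁻¹L = {w : ∃ u ∉ X, u^r++w ∈ L}`. -/
def drL {σ : Type*} (L X : Set (List σ)) : Set (List σ) :=
  {w | ∃ u, u ∉ X ∧ u.reverse ++ w ∈ L}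

theorem revLang_revLang {σ : Type*} (L : Set (List σ)) : revLang (revLang L) = L := by
  ext w
  simp [revLang]

theorem mem_leftQuotSet_revLang {σ : Type*} {L U : Set (List σ)} {w : List σ} :
    w ∈ leftQuotSet U (revLang L) ↔ ∃ v ∈ U, w.reverse ++ v.reverse ∈ L := by
  simp [leftQuotSet, revLang]

theorem mem_drL_revLang {σ : Type*} {L Y : Set (List σ)} {w : List σ} :
    w ∈ drL (revLang L) Y ↔ ∃ u, u ∉ Y ∧ w.reverse ++ u ∈ L := by
  simp [drL, revLang]

theorem drL_mem_LQ {σ : Type*} (L X : Set (List σ)) : drL L X ∈ LQ L := by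
  refine ⟨List.reverse '' Xᶜ, ?_⟩
  ext w
  simp only [drL, leftQuotSet, Set.exists_mem_image, Set.mem_ofPred_eq, Set.mem_compl_iff]

theorem drL_antitone {σ : Type*} (L : Set (List σ)) : Antitone (drL L) :=
  fun _ _ h _ ⟨u, hu, huw⟩ => ⟨u, fun hX => hu (h hX), huw⟩

theorem drL_revLang_drL {σ : Type*} {L X : Set (List σ)} (hX : X ∈ LQ (revLang L)) :
    drL (revLang L) (drL L X) = X := by
  obtain ⟨U, rfl⟩ := hX
  ext w
  rw [mem_drL_revLang]
  constructor
  · rintro ⟨u, hu, hwu⟩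
    by_contra hw
    exact hu ⟨w, hw, hwu⟩
  · intro hw
    obtain ⟨v, hv, hwv⟩ := mem_leftQuotSet_revLang.mp hw
    refine ⟨v.reverse, ?_, hwv⟩
    rintro ⟨x, hx, hxv⟩
    exact hx (mem_leftQuotSet_revLang.mpr ⟨v, hv, hxv⟩)

theorem leftQuot_inter_reverse_image_eq_empty_iff {σ : Type*} {L U : Set (List σ)}
    {u : List σ} :
    leftQuot u L ∩ (List.reverse '' U) = ∅ ↔ u.reverse ∉ leftQuotSet U (revLang L) := by
  rw [mem_leftQuotSet_revLang, List.reverse_reverse, Set.eq_empty_iff_forall_notMem]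
  constructor
  · rintro h ⟨v, hv, huv⟩
    exact h v.reverse ⟨huv, v, hv, rfl⟩
  · rintro h _ ⟨huv, v, hv, rfl⟩
    exact h ⟨v, hv, huv⟩

theorem drL_leftQuotSet_revLang {σ : Type*} (L U : Set (List σ)) :
    drL L (leftQuotSet U (revLang L)) =
      ⋃₀ {Y | ∃ u : List σ,
        Y = leftQuot u L ∧ leftQuot u L ∩ (List.reverse '' U) = ∅} := by
  ext w
  simp only [leftQuot_inter_reverse_image_eq_empty_iff]
  constructor
  · rintro ⟨u, hu, huw⟩
    exact ⟨_, ⟨u.reverse, rfl, by rwa [List.reverse_reverse]⟩, huw⟩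
  · rintro ⟨_, ⟨u, rfl, hu⟩, huw⟩
    exact ⟨u.reverse, hu, by rwa [List.reverse_reverse]⟩

/-- `dr_L` is an inclusion-reversing bijection from `LQ(L^r)` onto `LQ(L)` with
inverse `dr_{L^r}`, with alternative description on left quotients of `L^r`. -/
theorem drL_fundamental_duality {σ : Type*} (L : Set (List σ)) :
    -- (1) alternative description: dr_L(U⁻¹L^r) = ⋃ {u⁻¹L : u⁻¹L ∩ U^r = ∅}
    (∀ U : Set (List σ),
      drL L (leftQuotSet U (revLang L)) =
        ⋃₀ {Y | ∃ u : List σ,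
          Y = leftQuot u L ∧ leftQuot u L ∩ (List.reverse '' U) = ∅}) ∧
    -- (2) dr_{L^r} ∘ dr_L is the identity on LQ(L^r)
    (∀ X ∈ LQ (revLang L), drL (revLang L) (drL L X) = X) ∧
    -- (3) dr_L maps LQ(L^r) into LQ(L), dr_{L^r} maps LQ(L) into LQ(L^r),
    --     they are mutually inverse, and dr_L is inclusion-reversing
    (∀ X ∈ LQ (revLang L), drL L X ∈ LQ L) ∧
    (∀ Y ∈ LQ L, drL (revLang L) Y ∈ LQ (revLang L) ∧ drL L (drL (revLang L) Y) = Y) ∧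
    (∀ X₁ ∈ LQ (revLang L), ∀ X₂ ∈ LQ (revLang L), (X₁ ⊆ X₂ ↔ drL L X₂ ⊆ drL L X₁)) := by
  refine ⟨drL_leftQuotSet_revLang L, fun X hX => drL_revLang_drL hX,
    fun X _ => drL_mem_LQ L X, fun Y hY => ⟨drL_mem_LQ _ Y, ?_⟩, fun X₁ h₁ X₂ h₂ =>
    ⟨fun h => drL_antitone L h, fun h => ?_⟩⟩
  · have h := drL_revLang_drL (L := revLang L) (X := Y) (by rwa [revLang_revLang])
    rwa [revLang_revLang] at h
  · rw [← drL_revLang_drL h₁, ← drL_revLang_drL h₂]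
    exact drL_antitone _ h
end

section
/- For every language L ⊆ List Σ, every Y ∈ LQ(L) (i.e. Y = U⁻¹L for some set of words U) and every word v: Y ⊆ dr_L(v⁻¹L^r) if and only if v^r ∉ Y, where dr_L(X) := {w : ∃u ∉ X, u^r++w ∈ L}. -/
/-- For any left quotient `Y ∈ LQ(L)` and any word `v`:
`Y ⊆ dr_L(v⁻¹L^r)` iff `v^r ∉ Y`. -/
theorem subset_drL_iff {σ : Type*} (L Y : Set (List σ)) (hY : Y ∈ LQ L) (v : List σ) :
    Y ⊆ drL L (leftQuot v (revLang L)) ↔ v.reverse ∉ Y := by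
  obtain ⟨U, rfl⟩ := hY
  constructor
  · intro h hv
    obtain ⟨u, hu, huv⟩ := h hv
    exact hu (by simpa [leftQuot, revLang] using huv)
  · rintro hv w ⟨u, hu, huw⟩
    refine ⟨u.reverse, fun h => hv ⟨u, hu, ?_⟩, by simpa using huw⟩
    simpa [leftQuot, revLang] using h
end

section
/- Every left quotient is an intersection of images under dr_L of left word quotients of the reversed language: for every language L ⊆ List Σ and every Y ∈ LQ(L), Y = ⋂{dr_L(v⁻¹L^r) : v a word with v^r ∉ Y}, where dr_L(X) := {w : ∃u ∉ X, u^r++w ∈ L}. -/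
theorem mem_drL_leftQuot_revLang {σ : Type*} {L : Set (List σ)} {v w : List σ} :
    w ∈ drL L (leftQuot v (revLang L)) ↔ ∃ x, x ++ v.reverse ∉ L ∧ x ++ w ∈ L := by
  simp only [drL, leftQuot, revLang, Set.mem_ofPred_eq, List.reverse_append]
  exact (List.reverse_surjective.exists
    (p := fun x => x ++ v.reverse ∉ L ∧ x ++ w ∈ L)).symm

/-- Every left quotient `Y ∈ LQ(L)` is the intersection
`⋂ {dr_L(v⁻¹L^r) : v^r ∉ Y}` (the empty intersection being all of `List σ`). -/
theorem leftQuotient_eq_sInter_drL {σ : Type*} (L Y : Set (List σ)) (hY : Y ∈ LQ L) :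
    Y = ⋂₀ {S | ∃ v : List σ, v.reverse ∉ Y ∧ S = drL L (leftQuot v (revLang L))} := by
  obtain ⟨U, rfl⟩ := hY
  ext w
  constructor
  · rintro ⟨x, hxU, hxw⟩ S ⟨v, hv, rfl⟩
    exact mem_drL_leftQuot_revLang.2 ⟨x, fun hxv => hv ⟨x, hxU, hxv⟩, hxw⟩
  · intro hw
    by_contra hwY
    obtain ⟨x, hx, hxw⟩ := mem_drL_leftQuot_revLang.1
      (hw _ ⟨w.reverse, by rwa [List.reverse_reverse], rfl⟩)
    exact hx (by rwa [List.reverse_reverse])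
end

section
/- Quotient–atom bijection κ_L: for a language L ⊆ List Σ define the equivalence E_L(u,v) :⟺ for all words s, s++u ∈ L ↔ s++v ∈ L. Then: (1) for all words v₁, v₂: v₁⁻¹L^r = v₂⁻¹L^r if and only if E_L(v₁^r, v₂^r) (so v⁻¹L^r ↦ [v^r]_{E_L} is a well-defined bijection from the left word quotients of L^r onto the E_L-equivalence classes); (2) for every letter a and words x, y: (for all words u, E_L(u, x^r) implies E_L([a]++u, y^r)) if and only if (x++[a])⁻¹L^r = y⁻¹L^r; equivalently, the E_L-class of x^r is contained in a⁻¹ applied to the E_L-class of y^r exactly when (x++[a])⁻¹L^r = y⁻¹L^r. -/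
/-- The equivalence `E_L(u,v) :⟺ ∀ s, s++u ∈ L ↔ s++v ∈ L`. -/
def EL {σ : Type*} (L : Set (List σ)) (u v : List σ) : Prop :=
  ∀ s : List σ, s ++ u ∈ L ↔ s ++ v ∈ L

theorem leftQuot_revLang_eq_iff {σ : Type*} (L : Set (List σ)) (v₁ v₂ : List σ) :
    leftQuot v₁ (revLang L) = leftQuot v₂ (revLang L) ↔ EL L v₁.reverse v₂.reverse := by
  simp only [Set.ext_iff, leftQuot, revLang, EL, Set.mem_ofPred_eq, List.reverse_append]
  exact (List.reverse_surjective.forall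
    (p := fun s => s ++ v₁.reverse ∈ L ↔ s ++ v₂.reverse ∈ L)).symm

theorem EL.append_left {σ : Type*} {L : Set (List σ)} {u v : List σ} (h : EL L u v)
    (w : List σ) : EL L (w ++ u) (w ++ v) := fun s => by
  simpa only [List.append_assoc] using h (s ++ w)

/-- Quotient–atom bijection `κ_L`:
(1) left word quotients of `L^r` correspond exactly to `E_L`-classes, via
`v⁻¹L^r ↦ [v^r]_{E_L}`;
(2) the `E_L`-class of `x^r` is contained in `a⁻¹` applied to the `E_L`-class of
`y^r` exactly when `(x++[a])⁻¹L^r = y⁻¹L^r`. -/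
theorem quotient_atom_bijection {σ : Type*} (L : Set (List σ)) :
    (∀ v₁ v₂ : List σ,
      leftQuot v₁ (revLang L) = leftQuot v₂ (revLang L) ↔
        EL L v₁.reverse v₂.reverse) ∧
    (∀ (a : σ) (x y : List σ),
      (∀ u : List σ, EL L u x.reverse → EL L ([a] ++ u) y.reverse) ↔
        leftQuot (x ++ [a]) (revLang L) = leftQuot y (revLang L)) := by
  refine ⟨leftQuot_revLang_eq_iff L, fun a x y => ?_⟩
  rw [leftQuot_revLang_eq_iff, List.reverse_append, List.reverse_singleton]
  exact ⟨fun h => h _ fun _ => Iff.rfl,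
    fun h u hu s => (hu.append_left [a] s).trans (h s)⟩
end

section
/- Quotient–intersection relationship (λ_L): for every language L ⊆ List Σ, every letter a and all words x, y: ⋂{u⁻¹L : u a word with x^r ∈ u⁻¹L} ⊆ a⁻¹(⋂{u⁻¹L : u a word with y^r ∈ u⁻¹L}) if and only if y⁻¹L^r ⊆ (x++[a])⁻¹L^r. -/
/-- Left quotient of a language by a single letter: `a⁻¹X = {w : [a]++w ∈ X}`. -/
def letterQuot {σ : Type*} (a : σ) (X : Set (List σ)) : Set (List σ) :=
  {w | a :: w ∈ X}

/-- Quotient–intersection relationship (`λ_L`):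
`⋂{u⁻¹L : x^r ∈ u⁻¹L} ⊆ a⁻¹(⋂{u⁻¹L : y^r ∈ u⁻¹L})` iff
`y⁻¹L^r ⊆ (x++[a])⁻¹L^r`.  (Intersections over empty index sets are everything.) -/
theorem quotient_intersection_relationship {σ : Type*} (L : Set (List σ))
    (a : σ) (x y : List σ) :
    {w | ∀ u : List σ, x.reverse ∈ leftQuot u L → w ∈ leftQuot u L} ⊆
      letterQuot a {w | ∀ u : List σ, y.reverse ∈ leftQuot u L → w ∈ leftQuot u L} ↔
    leftQuot y (revLang L) ⊆ leftQuot (x ++ [a]) (revLang L) := by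
  constructor
  · intro h v hv
    have key := h (fun _ hu => hu) v.reverse (by simpa [leftQuot, revLang] using hv)
    simpa [leftQuot, revLang] using key
  · intro h w hw u hu
    have key := @h u.reverse (by simpa [leftQuot, revLang] using hu)
    have hx : x.reverse ∈ leftQuot (u ++ [a]) L := by
      simpa [leftQuot, revLang] using key
    simpa [leftQuot] using hw (u ++ [a]) hx
end

section
/- The syntactic semiring congruence is a congruence for union and concatenation of languages: for a language L ⊆ List Σ define S(U,V) :⟺ for all words x, y: (∃u ∈ U, x++u++y ∈ L) ↔ (∃v ∈ V, x++v++y ∈ L). If S(U₁,V₁) and S(U₂,V₂) then S(U₁ ∪ U₂, V₁ ∪ V₂) and S(U₁·U₂, V₁·V₂), where U·V := {u++v : u ∈ U, v ∈ V} is language concatenation. -/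
/-- Concatenation of languages: `U·V = {u++v : u ∈ U, v ∈ V}`. -/
def concatLang {σ : Type*} (U V : Set (List σ)) : Set (List σ) :=
  {w | ∃ u ∈ U, ∃ v ∈ V, w = u ++ v}

/-- The syntactic semiring congruence of `L`:
`S(U,V) :⟺ ∀ x y, (∃ u ∈ U, x++u++y ∈ L) ↔ (∃ v ∈ V, x++v++y ∈ L)`. -/
def synSrCong {σ : Type*} (L : Set (List σ)) (U V : Set (List σ)) : Prop :=
  ∀ x y : List σ, (∃ u ∈ U, x ++ u ++ y ∈ L) ↔ (∃ v ∈ V, x ++ v ++ y ∈ L)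

theorem synSrCong.symm {σ : Type*} {L U V : Set (List σ)} (h : synSrCong L U V) :
    synSrCong L V U :=
  fun x y => (h x y).symm

theorem synSrCong.exists_union {σ : Type*} {L U₁ V₁ U₂ V₂ : Set (List σ)}
    (h₁ : synSrCong L U₁ V₁) (h₂ : synSrCong L U₂ V₂) {x y : List σ}
    (h : ∃ u ∈ U₁ ∪ U₂, x ++ u ++ y ∈ L) : ∃ v ∈ V₁ ∪ V₂, x ++ v ++ y ∈ L := by
  obtain ⟨u, hu | hu, hL⟩ := h
  · obtain ⟨v, hv, hL'⟩ := (h₁ x y).1 ⟨u, hu, hL⟩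
    exact ⟨v, Or.inl hv, hL'⟩
  · obtain ⟨v, hv, hL'⟩ := (h₂ x y).1 ⟨u, hu, hL⟩
    exact ⟨v, Or.inr hv, hL'⟩

theorem synSrCong.exists_concatLang {σ : Type*} {L U₁ V₁ U₂ V₂ : Set (List σ)}
    (h₁ : synSrCong L U₁ V₁) (h₂ : synSrCong L U₂ V₂) {x y : List σ}
    (h : ∃ u ∈ concatLang U₁ U₂, x ++ u ++ y ∈ L) :
    ∃ v ∈ concatLang V₁ V₂, x ++ v ++ y ∈ L := by
  obtain ⟨_, ⟨u₁, hu₁, u₂, hu₂, rfl⟩, hL⟩ := h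
  obtain ⟨v₁, hv₁, hL₁⟩ := (h₁ x (u₂ ++ y)).1 ⟨u₁, hu₁, by simpa using hL⟩
  obtain ⟨v₂, hv₂, hL₂⟩ := (h₂ (x ++ v₁) y).1 ⟨u₂, hu₂, by simpa using hL₁⟩
  exact ⟨v₁ ++ v₂, ⟨v₁, hv₁, v₂, hv₂, rfl⟩, by simpa using hL₂⟩

/-- The syntactic semiring congruence is a congruence for union and concatenation. -/
theorem synSrCong_union_and_concat {σ : Type*} (L : Set (List σ))
    (U₁ V₁ U₂ V₂ : Set (List σ))
    (h₁ : synSrCong L U₁ V₁) (h₂ : synSrCong L U₂ V₂) :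
    synSrCong L (U₁ ∪ U₂) (V₁ ∪ V₂) ∧
    synSrCong L (concatLang U₁ U₂) (concatLang V₁ V₂) :=
  ⟨fun _ _ => ⟨h₁.exists_union h₂, h₁.symm.exists_union h₂.symm⟩,
    fun _ _ => ⟨h₁.exists_concatLang h₂, h₁.symm.exists_concatLang h₂.symm⟩⟩
end

section
/- In any dependency automaton the upper NFA accepts the reverse of the language of the lower NFA: let G ⊆ S × T be a relation between sets, let N be a relational NFA on state set S and N' a relational NFA on state set T such that for every letter a, N_a ; G = G ; (N'_a)˘ (as relations in S × T), and such that F_{N'} = G[I_N] and F_N = G˘[I_{N'}]. Then L(N') = (L(N))^r. -/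
namespace RelNFA

theorem runRel_concat {σ Z : Type*} (N : RelNFA σ Z) (u : List σ) (a : σ) (z z' : Z) :
    N.runRel (u ++ [a]) z z' ↔ ∃ y, N.runRel u z y ∧ N.tr a y z' := by
  simp [runRel, List.foldl_append]

theorem runRel_cons {σ Z : Type*} (N : RelNFA σ Z) (a : σ) (u : List σ) (z z' : Z) :
    N.runRel (a :: u) z z' ↔ ∃ y, N.tr a z y ∧ N.runRel u y z' := by
  induction u using List.reverseRecOn generalizing z' with
  | nil => simp [runRel]
  | append_singleton u b ih =>
    rw [← List.cons_append]
    simp only [runRel_concat, ih]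
    grind

theorem runRel_reverse_comp_iff {σ S T : Type*} {G : S → T → Prop}
    {N : RelNFA σ S} {N' : RelNFA σ T}
    (htr : ∀ (a : σ) (s : S) (t : T),
      (∃ s', N.tr a s s' ∧ G s' t) ↔ (∃ t', G s t' ∧ N'.tr a t t'))
    (w : List σ) (s : S) (t : T) :
    (∃ s', N.runRel w.reverse s s' ∧ G s' t) ↔ (∃ t', G s t' ∧ N'.runRel w t t') := by
  induction w using List.reverseRecOn generalizing s with
  | nil => simp [runRel]
  | append_singleton u a ih =>
    simp only [List.reverse_append, List.reverse_singleton, List.singleton_append,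
      runRel_cons, runRel_concat]
    constructor
    · rintro ⟨s', ⟨y, hy, hrun⟩, hG⟩
      obtain ⟨t', hG', hrun'⟩ := (ih y).1 ⟨s', hrun, hG⟩
      obtain ⟨t'', hG'', ht⟩ := (htr a s t').1 ⟨y, hy, hG'⟩
      exact ⟨t'', hG'', t', hrun', ht⟩
    · rintro ⟨t'', hG'', t', hrun', ht⟩
      obtain ⟨y, hy, hG'⟩ := (htr a s t').2 ⟨t'', hG'', ht⟩
      obtain ⟨s', hrun, hG⟩ := (ih y).2 ⟨t', hG', hrun'⟩
      exact ⟨s', ⟨y, hy, hrun⟩, hG⟩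

end RelNFA

/-- In a dependency automaton the upper nfa accepts the reverse of the language
of the lower nfa: if `N_a ; G = G ; (N'_a)˘` for every letter `a`,
`F_{N'} = G[I_N]` and `F_N = G˘[I_{N'}]`, then `L(N') = (L(N))^r`. -/
theorem upper_nfa_accepts_reverse {σ S T : Type*} (G : S → T → Prop)
    (N : RelNFA σ S) (N' : RelNFA σ T)
    (htr : ∀ (a : σ) (s : S) (t : T),
      (∃ s', N.tr a s s' ∧ G s' t) ↔ (∃ t', G s t' ∧ N'.tr a t t'))
    (hF' : N'.F = {t | ∃ s ∈ N.I, G s t})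
    (hF : N.F = {s | ∃ t ∈ N'.I, G s t}) :
    N'.lang = {w | w.reverse ∈ N.lang} := by
  ext w
  constructor
  · rintro ⟨t', ⟨t, ht, hrun'⟩, htF⟩
    rw [hF'] at htF
    obtain ⟨s, hs, hG⟩ := htF
    obtain ⟨s', hrun, hG'⟩ := (RelNFA.runRel_reverse_comp_iff htr w s t).2 ⟨t', hG, hrun'⟩
    exact ⟨s', ⟨s, hs, hrun⟩, hF ▸ ⟨t, ht, hG'⟩⟩
  · rintro ⟨s', ⟨s, hs, hrun⟩, hsF⟩
    rw [hF] at hsF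
    obtain ⟨t, ht, hG⟩ := hsF
    obtain ⟨t', hG', hrun'⟩ := (RelNFA.runRel_reverse_comp_iff htr w s t).1 ⟨s', hrun, hG⟩
    exact ⟨t', ⟨t, ht, hrun'⟩, hF' ▸ ⟨s, hs, hG'⟩⟩
end

section
/- Soundness of the NFA induced by a biclique edge-covering of the dependency relation (the Kameda–Weiner construction): let L ⊆ List Σ be a language. Call a pair (A,B) of sets of languages an R_L-biclique when A ⊆ LW(L), B ⊆ LW(L^r), and for all words u, v with u⁻¹L ∈ A and v⁻¹L^r ∈ B one has u++v^r ∈ L. Let C be any set of R_L-bicliques and define the NFA N_C with state set C, initial states {(A,B) ∈ C : L ∈ A}, final states {(A,B) ∈ C : ε ∈ ⋂A}, and a-transitions (A₁,B₁) →_a (A₂,B₂) iff {a⁻¹X : X ∈ A₁} ⊆ A₂. Then: (1) if a state (A,B) of N_C is reachable from the initial states by reading the word u, then u⁻¹L ∈ A; and consequently (2) L(N_C) ⊆ L. -/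
/-- The left word quotients of `L`: `LW(L) = {u⁻¹L : u a word}`. -/
def LW {σ : Type*} (L : Set (List σ)) : Set (Set (List σ)) :=
  {Y | ∃ u : List σ, Y = leftQuot u L}

/-- A pair of sets of languages, thought of as a potential biclique of the
dependency relation `R_L`. -/
abbrev Bic (σ : Type*) := Set (Set (List σ)) × Set (Set (List σ))

/-- `(A,B)` is an `R_L`-biclique: `A ⊆ LW(L)`, `B ⊆ LW(L^r)` and
`A × B ⊆ R_L`, i.e. `u⁻¹L ∈ A` and `v⁻¹L^r ∈ B` imply `u++v^r ∈ L`. -/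
def IsBiclique {σ : Type*} (L : Set (List σ)) (p : Bic σ) : Prop :=
  p.1 ⊆ LW L ∧ p.2 ⊆ LW (revLang L) ∧
  ∀ u v : List σ, leftQuot u L ∈ p.1 → leftQuot v (revLang L) ∈ p.2 →
    u ++ v.reverse ∈ L

/-- The nfa induced by a set `C` of bicliques (the Kameda–Weiner construction):
states are the members of `C`, `(A,B)` is initial iff `L ∈ A`, final iff
`ε ∈ ⋂A`, and `(A₁,B₁) →ₐ (A₂,B₂)` iff `{a⁻¹X : X ∈ A₁} ⊆ A₂`. -/
def coverNFA {σ : Type*} (L : Set (List σ)) (C : Set (Bic σ)) :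
    RelNFA σ {p : Bic σ // p ∈ C} where
  I := {p | L ∈ p.1.1}
  F := {p | ([] : List σ) ∈ ⋂₀ p.1.1}
  tr := fun a p q => letterQuot a '' p.1.1 ⊆ q.1.1

theorem RelNFA.runRel_append_singleton {σ Z : Type*} (N : RelNFA σ Z) (w : List σ) (a : σ)
    (z z' : Z) : N.runRel (w ++ [a]) z z' ↔ ∃ y, N.runRel w z y ∧ N.tr a y z' := by
  simp [RelNFA.runRel]

theorem letterQuot_leftQuot {σ : Type*} (a : σ) (u : List σ) (L : Set (List σ)) :
    letterQuot a (leftQuot u L) = leftQuot (u ++ [a]) L := by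
  ext w
  simp [letterQuot, leftQuot]

theorem leftQuot_mem_of_mem_imgSet {σ : Type*} (L : Set (List σ)) (C : Set (Bic σ))
    (u : List σ) (p : {p : Bic σ // p ∈ C})
    (hp : p ∈ (coverNFA L C).imgSet u (coverNFA L C).I) : leftQuot u L ∈ p.1.1 := by
  induction u using List.reverseRecOn generalizing p with
  | nil =>
    obtain ⟨q, hq, rfl⟩ := hp
    exact hq
  | append_singleton u a ih =>
    obtain ⟨q, hq, hrun⟩ := hp
    obtain ⟨y, hy, htr⟩ := (RelNFA.runRel_append_singleton _ _ _ _ _).1 hrun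
    rw [← letterQuot_leftQuot]
    exact htr ⟨_, ih y ⟨q, hq, hy⟩, rfl⟩

/-- Soundness of the Kameda–Weiner induced nfa: (1) any state reached from the
initial states by reading `u` has `u⁻¹L` in its first component, and hence
(2) the induced nfa accepts at most `L`. -/
theorem coverNFA_sound {σ : Type*} (L : Set (List σ)) (C : Set (Bic σ))
    (hC : ∀ p ∈ C, IsBiclique L p) :
    (∀ (u : List σ) (p : {p : Bic σ // p ∈ C}),
      p ∈ (coverNFA L C).imgSet u (coverNFA L C).I → leftQuot u L ∈ p.1.1) ∧
    (coverNFA L C).lang ⊆ L := by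
  refine ⟨leftQuot_mem_of_mem_imgSet L C, ?_⟩
  rintro w ⟨p, hp, hF⟩
  simpa [leftQuot] using hF _ (leftQuot_mem_of_mem_imgSet L C w p hp)
end
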